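/- arXiv:2302.05620 — 9 statements merged into one kernel-verified Lean document; each statement's English description precedes it below -/
import Mathlib

section
/- Let f, g : ℝ^d → ℝ be differentiable functions such that f is convex on K and α-smooth on K. Let x⋆ ∈ K be a minimizer of f over K and y⋆ ∈ K a minimizer of g over K. Let x ∈ K, let v ∈ K be a linear-optimization step at x for f, let σ ∈ [0,1], and set x' = (1−σ)x + σv. Let δ be a real number with |g(u) − f(u)| ≤ δ for all u ∈ K. Then g(x') − g(y⋆) ≤ δ + (1−σ)(f(x) − f(x⋆)) + ασ²D²/2 + f(x⋆) − g(y⋆). -/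
open RealInnerProductSpace

/-- First-order lower bound for a convex function at a point of differentiability. -/
theorem ConvexOn.add_inner_gradient_le {E : Type*} [NormedAddCommGroup E]
    [InnerProductSpace ℝ E] [CompleteSpace E] {K : Set E} {f : E → ℝ} (hf : ConvexOn ℝ K f)
    {x u : E} (hx : x ∈ K) (hu : u ∈ K) (hfx : DifferentiableAt ℝ f x) :
    f x + ⟪gradient f x, u - x⟫ ≤ f u := by
  have hconv : ConvexOn ℝ (Set.Icc (0 : ℝ) 1) (f ∘ AffineMap.lineMap (k := ℝ) x u) :=
    (hf.comp_affineMap (AffineMap.lineMap x u)).subset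
      (fun _ ht => hf.1.lineMap_mem hx hu ht) (convex_Icc 0 1)
  have hderiv : HasDerivAt (f ∘ AffineMap.lineMap (k := ℝ) x u) ⟪gradient f x, u - x⟫ 0 := by
    have hgrad : HasFDerivAt f (InnerProductSpace.toDual ℝ E (gradient f x))
        (AffineMap.lineMap x u (0 : ℝ)) := by
      simpa using hfx.hasGradientAt.hasFDerivAt
    simpa using hgrad.comp_hasDerivAt (0 : ℝ) AffineMap.hasDerivAt_lineMap
  have hslope := hconv.le_slope_of_hasDerivAt (x := 0) (y := 1) (by simp) (by simp)
    one_pos hderiv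
  simp only [slope_def_field, Function.comp_apply, AffineMap.lineMap_apply_zero,
    AffineMap.lineMap_apply_one, sub_zero, div_one] at hslope
  linarith

/-- Lemma: one OFW step with fixed step size, smooth convex case. -/
theorem ofw_one_step_fixed_step
    {d : ℕ} {K : Set (EuclideanSpace ℝ (Fin d))}
    (hKne : K.Nonempty) (hKconv : Convex ℝ K)
    {D : ℝ} (hD : 0 < D) (hdiam : ∀ x ∈ K, ∀ y ∈ K, ‖x - y‖ ≤ D)
    {α : ℝ} (hα : 0 < α)
    {f g : EuclideanSpace ℝ (Fin d) → ℝ}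
    (hfdiff : Differentiable ℝ f) (hgdiff : Differentiable ℝ g)
    (hfconv : ConvexOn ℝ K f)
    (hfsmooth : ∀ x ∈ K, ∀ y ∈ K,
      f y ≤ f x + ⟪gradient f x, y - x⟫ + α / 2 * ‖x - y‖ ^ 2)
    {xstar ystar : EuclideanSpace ℝ (Fin d)}
    (hxstarK : xstar ∈ K) (hxstar : ∀ u ∈ K, f xstar ≤ f u)
    (hystarK : ystar ∈ K) (hystar : ∀ u ∈ K, g ystar ≤ g u)
    {x v : EuclideanSpace ℝ (Fin d)} (hxK : x ∈ K) (hvK : v ∈ K)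
    (hv : ∀ u ∈ K, ⟪gradient f x, v⟫ ≤ ⟪gradient f x, u⟫)
    {σ : ℝ} (hσ : σ ∈ Set.Icc (0 : ℝ) 1)
    {x' : EuclideanSpace ℝ (Fin d)} (hx' : x' = (1 - σ) • x + σ • v)
    {δ : ℝ} (hδ : ∀ u ∈ K, |g u - f u| ≤ δ) :
    g x' - g ystar ≤
      δ + (1 - σ) * (f x - f xstar) + α * σ ^ 2 * D ^ 2 / 2 + f xstar - g ystar := by
  obtain ⟨hσ0, hσ1⟩ := hσ
  have hx'K : x' ∈ K := hx' ▸ hKconv hxK hvK (sub_nonneg.2 hσ1) hσ0 (by ring)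
  have hstep : x' - x = σ • (v - x) := by rw [hx']; module
  have hsmooth := hfsmooth x hxK x' hx'K
  rw [norm_sub_rev, hstep, inner_smul_right, norm_smul, mul_pow, Real.norm_eq_abs, sq_abs,
    inner_sub_right] at hsmooth
  have hgap := hfconv.add_inner_gradient_le hxK hxstarK hfdiff.differentiableAt
  rw [inner_sub_right] at hgap
  have hlinear : σ * (⟪gradient f x, v⟫ - ⟪gradient f x, x⟫) ≤ σ * (f xstar - f x) :=
    mul_le_mul_of_nonneg_left (by linarith [hv xstar hxstarK]) hσ0
  have hquad : α / 2 * (σ ^ 2 * ‖v - x‖ ^ 2) ≤ α / 2 * (σ ^ 2 * D ^ 2) := by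
    gcongr
    exact hdiam v hvK x hxK
  linarith [le_of_abs_le (hδ x' hx'K)]
end

section
/- Let f, g : ℝ^d → ℝ be differentiable functions such that f is convex on K and α-smooth on K. Let x⋆ ∈ K be a minimizer of f over K and y⋆ ∈ K a minimizer of g over K. Let x ∈ K, let v ∈ K be a linear-optimization step at x for f, let σ_t ∈ [0,1] be a line-search step size at (x, v) for f, and set x' = (1−σ_t)x + σ_t v. Let δ be a real number with |g(u) − f(u)| ≤ δ for all u ∈ K. Then for every σ⋆ ∈ [0,1], g(x') − g(y⋆) ≤ δ + (1−σ⋆)(f(x) − f(x⋆)) + ασ⋆²D²/2 + f(x⋆) − g(y⋆). -/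
open RealInnerProductSpace

/-- First-order condition: a convex function lies above its tangent hyperplanes. -/
theorem ConvexOn.inner_gradient_sub_le {E : Type*} [NormedAddCommGroup E]
    [InnerProductSpace ℝ E] [CompleteSpace E] {s : Set E} {f : E → ℝ} {x y : E}
    (hf : ConvexOn ℝ s f) (hfx : DifferentiableAt ℝ f x) (hx : x ∈ s) (hy : y ∈ s) :
    ⟪gradient f x, y - x⟫ ≤ f y - f x := by
  have hline : HasDerivAt (f ∘ AffineMap.lineMap (k := ℝ) x y) ⟪gradient f x, y - x⟫ 0 := by
    have hgrad : HasFDerivAt f (InnerProductSpace.toDual ℝ E (gradient f x))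
        (AffineMap.lineMap (k := ℝ) x y 0) := by
      simpa using hfx.hasGradientAt.hasFDerivAt
    simpa using hgrad.comp_hasDerivAt (0 : ℝ) AffineMap.hasDerivAt_lineMap
  have hconv := hf.comp_affineMap (AffineMap.lineMap (k := ℝ) x y)
  have hslope := hconv.le_slope_of_hasDerivAt (x := 0) (y := 1)
    (by simpa using hx) (by simpa using hy) one_pos hline
  simpa [slope_def_field] using hslope

/-- Lemma 3: one OFW step with line search, smooth convex case. -/
theorem ofw_one_step_line_search
    {d : ℕ} {K : Set (EuclideanSpace ℝ (Fin d))}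
    (hKne : K.Nonempty) (hKconv : Convex ℝ K)
    {D : ℝ} (hD : 0 < D) (hdiam : ∀ x ∈ K, ∀ y ∈ K, ‖x - y‖ ≤ D)
    {α : ℝ} (hα : 0 < α)
    {f g : EuclideanSpace ℝ (Fin d) → ℝ}
    (hfdiff : Differentiable ℝ f) (hgdiff : Differentiable ℝ g)
    (hfconv : ConvexOn ℝ K f)
    (hfsmooth : ∀ x ∈ K, ∀ y ∈ K,
      f y ≤ f x + ⟪gradient f x, y - x⟫ + α / 2 * ‖x - y‖ ^ 2)
    {xstar ystar : EuclideanSpace ℝ (Fin d)}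
    (hxstarK : xstar ∈ K) (hxstar : ∀ u ∈ K, f xstar ≤ f u)
    (hystarK : ystar ∈ K) (hystar : ∀ u ∈ K, g ystar ≤ g u)
    {x v : EuclideanSpace ℝ (Fin d)} (hxK : x ∈ K) (hvK : v ∈ K)
    (hv : ∀ u ∈ K, ⟪gradient f x, v⟫ ≤ ⟪gradient f x, u⟫)
    {σt : ℝ} (hσt : σt ∈ Set.Icc (0 : ℝ) 1)
    (hls : ∀ σ' ∈ Set.Icc (0 : ℝ) 1,
      σt * ⟪gradient f x, v - x⟫ + α * σt ^ 2 / 2 * ‖x - v‖ ^ 2 ≤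
        σ' * ⟪gradient f x, v - x⟫ + α * σ' ^ 2 / 2 * ‖x - v‖ ^ 2)
    {x' : EuclideanSpace ℝ (Fin d)} (hx' : x' = (1 - σt) • x + σt • v)
    {δ : ℝ} (hδ : ∀ u ∈ K, |g u - f u| ≤ δ) :
    ∀ σstar ∈ Set.Icc (0 : ℝ) 1,
      g x' - g ystar ≤
        δ + (1 - σstar) * (f x - f xstar) + α * σstar ^ 2 * D ^ 2 / 2
          + f xstar - g ystar := by
  intro σ hσ
  have hstep : x' - x = σt • (v - x) := by rw [hx']; module
  have hx'K : x' ∈ K := by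
    rw [hx']
    exact hKconv hxK hvK (sub_nonneg.2 hσt.2) hσt.1 (by ring)
  have hnorm : ‖x - x'‖ ^ 2 = σt ^ 2 * ‖x - v‖ ^ 2 := by
    rw [norm_sub_rev, hstep, norm_smul, mul_pow, Real.norm_eq_abs, sq_abs, norm_sub_rev]
  have hdescent := hfsmooth x hxK x' hx'K
  rw [hnorm, hstep, inner_smul_right] at hdescent
  have hgap : ⟪gradient f x, v - x⟫ ≤ f xstar - f x := by
    have htangent := hfconv.inner_gradient_sub_le (hfdiff x) hxK hxstarK
    have hmin := hv xstar hxstarK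
    rw [inner_sub_right] at htangent ⊢
    linarith
  have hlinear := mul_le_mul_of_nonneg_left hgap hσ.1
  have hquad : α * σ ^ 2 / 2 * ‖x - v‖ ^ 2 ≤ α * σ ^ 2 / 2 * D ^ 2 := by
    gcongr
    exact hdiam x hxK v hvK
  have hclose := (abs_le.1 (hδ x' hx'K)).2
  linarith [hls σ hσ]
end

section
/- Suppose K is β_K-strongly convex. Let f_1, …, f_T : ℝ^d → ℝ be differentiable functions, each convex on K, α-smooth on K, and β_f-strongly convex on K, and for each t let x_t⋆ ∈ K be a minimizer of f_t over K. Let x_1 ∈ K, and for each t = 1, …, T−1 let v_t ∈ K be a linear-optimization step at x_t for f_t, let σ_t ∈ [0,1] be a line-search step size at (x_t, v_t) for f_t, and set x_{t+1} = (1−σ_t)x_t + σ_t v_t (OFW with line search). Let M satisfy 2|f_t(u)| ≤ M for all t and all u ∈ K, let δ_2, …, δ_T be reals with |f_t(u) − f_{t−1}(u)| ≤ δ_t for all u ∈ K, and set V_T = Σ_{t=2}^T δ_t. Then Σ_{t=1}^T f_t(x_t) − Σ_{t=1}^T f_t(x_t⋆) ≤ ((8√2·α/(√β_f·β_K))·(M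 + V_T))^{2/3}·T^{1/3} + 2(M + V_T). -/
open RealInnerProductSpace Finset

section FrankWolfeStep

variable {E : Type*} [NormedAddCommGroup E] [InnerProductSpace ℝ E]

/-- Over a strongly convex set, the Frank–Wolfe gap dominates the squared step length. -/
lemma norm_mul_sq_le_inner_of_stronglyConvex_set {K : Set E} {β : ℝ}
    (hK : ∀ x ∈ K, ∀ y ∈ K, ∀ γ ∈ Set.Icc (0 : ℝ) 1, ∀ z : E, ‖z‖ = 1 →
      γ • x + (1 - γ) • y + (γ * (1 - γ) * (β / 2) * ‖x - y‖ ^ 2) • z ∈ K)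
    {g x v : E} (hx : x ∈ K) (hv : v ∈ K) (hmin : ∀ u ∈ K, ⟪g, v⟫ ≤ ⟪g, u⟫) :
    β / 4 * ‖g‖ * ‖x - v‖ ^ 2 ≤ ⟪g, x - v⟫ := by
  rcases eq_or_ne g 0 with rfl | hg
  · simp
  have hn : ‖g‖ ≠ 0 := norm_ne_zero_iff.2 hg
  have hz : ‖(-(‖g‖⁻¹)) • g‖ = 1 := by
    rw [norm_smul, norm_neg, norm_inv, norm_norm, inv_mul_cancel₀ hn]
  have h := hmin _ (hK x hx v hv (1 / 2) ⟨by norm_num, by norm_num⟩ _ hz)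
  have hgg : -(‖g‖⁻¹) * ⟪g, g⟫ = -‖g‖ := by
    rw [real_inner_self_eq_norm_sq]
    field_simp
  simp only [inner_add_right, inner_smul_right, hgg] at h
  rw [inner_sub_right]
  linarith

/-- A strongly convex function satisfies the Polyak–Łojasiewicz inequality. -/
lemma mul_sub_le_norm_sq_of_stronglyConvex {β a b : ℝ} (hβ : 0 < β) {g x y : E}
    (h : a + ⟪g, y - x⟫ + β / 2 * ‖x - y‖ ^ 2 ≤ b) :
    2 * β * (a - b) ≤ ‖g‖ ^ 2 := by
  have h1 := abs_le.1 (abs_real_inner_le_norm g (y - x))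
  rw [norm_sub_rev y x] at h1
  nlinarith [sq_nonneg (‖g‖ - β * ‖x - y‖), mul_le_mul_of_nonneg_left h hβ.le,
    mul_le_mul_of_nonneg_left h1.1 hβ.le]

/-- The decrease of a smooth and strongly convex function over a strongly convex set along one
Frank–Wolfe step with line search. -/
lemma min_le_sub_of_line_search {α βK βf : ℝ} (hα : 0 < α) (hβK : 0 < βK) (hβf : 0 < βf)
    {fx fx' fs σ : ℝ} {g x v s : E}
    (hgap : βK / 4 * ‖g‖ * ‖x - v‖ ^ 2 ≤ ⟪g, x - v⟫)
    (hs : fs ≤ fx) (hmin : ⟪g, v⟫ ≤ ⟪g, s⟫)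
    (hsc : fx + ⟪g, s - x⟫ + βf / 2 * ‖x - s‖ ^ 2 ≤ fs)
    (hsmooth : fx' ≤ fx + σ * ⟪g, v - x⟫ + α * σ ^ 2 / 2 * ‖x - v‖ ^ 2)
    (hls : ∀ σ' ∈ Set.Icc (0 : ℝ) 1,
      σ * ⟪g, v - x⟫ + α * σ ^ 2 / 2 * ‖x - v‖ ^ 2 ≤
        σ' * ⟪g, v - x⟫ + α * σ' ^ 2 / 2 * ‖x - v‖ ^ 2) :
    min ((fx - fs) / 2) (βK * (√2 * √βf) / (8 * α) * ((fx - fs) * √(fx - fs))) ≤ fx - fx' := by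
  have hPL : √2 * √βf * √(fx - fs) ≤ ‖g‖ := by
    rw [← Real.sqrt_mul (by norm_num), ← Real.sqrt_mul (by positivity)]
    apply Real.sqrt_le_iff.2 ⟨norm_nonneg _, ?_⟩
    exact mul_sub_le_norm_sq_of_stronglyConvex hβf hsc
  have hneg : ⟪g, v - x⟫ = -⟪g, x - v⟫ := by rw [← inner_neg_right, neg_sub]
  have hG : fx - fs ≤ ⟪g, x - v⟫ := by
    rw [inner_sub_right] at hsc ⊢
    nlinarith [sq_nonneg ‖x - s‖]
  set G := ⟪g, x - v⟫
  set h := fx - fs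
  have hh : 0 ≤ h := sub_nonneg.2 hs
  set τ := min 1 (βK * ‖g‖ / (4 * α)) with hτ
  have hτ0 : 0 ≤ τ := le_min zero_le_one (by positivity)
  have hτG : α * τ * ‖x - v‖ ^ 2 ≤ G := by
    refine le_trans (mul_le_mul_of_nonneg_right ?_ (sq_nonneg _)) hgap
    calc α * τ ≤ α * (βK * ‖g‖ / (4 * α)) := by gcongr; exact min_le_right _ _
      _ = βK / 4 * ‖g‖ := by field_simp
  have hdec : τ * h / 2 ≤ fx - fx' := by
    have h1 := hls τ ⟨hτ0, min_le_left _ _⟩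
    rw [hneg] at h1 hsmooth
    nlinarith [mul_le_mul_of_nonneg_left hτG hτ0, mul_le_mul_of_nonneg_left hG hτ0]
  refine le_trans ?_ hdec
  rcases min_choice 1 (βK * ‖g‖ / (4 * α)) with h1 | h1
  · rw [hτ, h1, one_mul]
    exact min_le_left _ _
  · rw [hτ, h1]
    refine (min_le_right _ _).trans ?_
    calc βK * (√2 * √βf) / (8 * α) * (h * √h)
        = βK * (√2 * √βf * √h) / (4 * α) * h / 2 := by field_simp; ring
      _ ≤ βK * ‖g‖ / (4 * α) * h / 2 := by gcongr

end FrankWolfeStep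

/-- Hölder's inequality with exponents `3 / 2` and `3` against the constant sequence. -/
lemma sum_le_rpow_sum_mul_card_rpow {ι : Type*} (s : Finset ι) {a : ι → ℝ}
    (ha : ∀ i ∈ s, 0 ≤ a i) :
    ∑ i ∈ s, a i ≤ (∑ i ∈ s, a i * √(a i)) ^ ((2 : ℝ) / 3) * (#s : ℝ) ^ ((1 : ℝ) / 3) := by
  have hpq : Real.HolderConjugate (3 / 2) 3 := by
    rw [Real.holderConjugate_iff]; norm_num
  have h := Real.inner_le_Lp_mul_Lq_of_nonneg s hpq ha (g := fun _ => 1) (by simp)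
  have hpow : ∀ i ∈ s, a i ^ ((3 : ℝ) / 2) = a i * √(a i) := fun i hi => by
    rw [Real.sqrt_eq_rpow, ← Real.rpow_one_add' (ha i hi) (by norm_num)]
    norm_num
  rw [Finset.sum_congr rfl hpow] at h
  simpa [show (1 : ℝ) / (3 / 2) = 2 / 3 by norm_num] using h

/-- If the sum of `min (h i / 2) (c * h i ^ (3 / 2))` is at most `S`, then the sum of the `h i` is
controlled by `S`. -/
lemma sum_le_of_sum_min_le {ι : Type*} (s : Finset ι) {h : ι → ℝ} {c S : ℝ} (hc : 0 < c)
    (hh : ∀ i ∈ s, 0 ≤ h i) (hS : ∑ i ∈ s, min (h i / 2) (c * (h i * √(h i))) ≤ S) :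
    ∑ i ∈ s, h i ≤ (S / c) ^ ((2 : ℝ) / 3) * (#s : ℝ) ^ ((1 : ℝ) / 3) + 2 * S := by
  have key : ∀ i ∈ s, ∃ a, 0 ≤ a ∧ h i ≤ a + 2 * min (h i / 2) (c * (h i * √(h i))) ∧
      c * (a * √a) ≤ min (h i / 2) (c * (h i * √(h i))) := fun i hi => by
    have h0 := hh i hi
    have hnn : 0 ≤ c * (h i * √(h i)) := by positivity
    rcases le_total (h i / 2) (c * (h i * √(h i))) with hle | hle
    · refine ⟨0, le_rfl, ?_, ?_⟩ <;> rw [min_eq_left hle]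
      · linarith
      · simpa using div_nonneg h0 zero_le_two
    · refine ⟨h i, h0, ?_, ?_⟩ <;> rw [min_eq_right hle]
      linarith
  choose! a ha0 ha1 ha2 using key
  have hle : ∑ i ∈ s, a i * √(a i) ≤ S / c := by
    rw [le_div_iff₀' hc, Finset.mul_sum]
    exact (Finset.sum_le_sum ha2).trans hS
  have hnn : 0 ≤ ∑ i ∈ s, a i * √(a i) :=
    Finset.sum_nonneg fun i hi => mul_nonneg (ha0 i hi) (Real.sqrt_nonneg _)
  calc ∑ i ∈ s, h i ≤ ∑ i ∈ s, a i + 2 * ∑ i ∈ s, min (h i / 2) (c * (h i * √(h i))) := by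
        rw [Finset.mul_sum, ← Finset.sum_add_distrib]
        exact Finset.sum_le_sum ha1
    _ ≤ (∑ i ∈ s, a i * √(a i)) ^ ((2 : ℝ) / 3) * (#s : ℝ) ^ ((1 : ℝ) / 3) + 2 * S := by
        gcongr
        exact sum_le_rpow_sum_mul_card_rpow s ha0
    _ ≤ _ := by gcongr

/-- Theorem 3: dynamic regret of OFW with line search over a strongly
convex set, for smooth and strongly convex functions. -/
theorem ofw_line_search_dynamic_regret_strongly_convex
    {d T : ℕ} (hT : 1 ≤ T) {K : Set (EuclideanSpace ℝ (Fin d))}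
    (hKne : K.Nonempty) (hKconv : Convex ℝ K)
    {D : ℝ} (hD : 0 < D) (hdiam : ∀ x ∈ K, ∀ y ∈ K, ‖x - y‖ ≤ D)
    {βK : ℝ} (hβK : 0 < βK)
    (hKsc : ∀ x ∈ K, ∀ y ∈ K, ∀ γ ∈ Set.Icc (0 : ℝ) 1,
      ∀ z : EuclideanSpace ℝ (Fin d), ‖z‖ = 1 →
        γ • x + (1 - γ) • y + (γ * (1 - γ) * (βK / 2) * ‖x - y‖ ^ 2) • z ∈ K)
    {α βf : ℝ} (hα : 0 < α) (hβf : 0 < βf)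
    {f : ℕ → EuclideanSpace ℝ (Fin d) → ℝ}
    (hfdiff : ∀ t ∈ Finset.Icc 1 T, Differentiable ℝ (f t))
    (hfconv : ∀ t ∈ Finset.Icc 1 T, ConvexOn ℝ K (f t))
    (hfsmooth : ∀ t ∈ Finset.Icc 1 T, ∀ x ∈ K, ∀ y ∈ K,
      f t y ≤ f t x + ⟪gradient (f t) x, y - x⟫ + α / 2 * ‖x - y‖ ^ 2)
    (hfsc : ∀ t ∈ Finset.Icc 1 T, ∀ x ∈ K, ∀ y ∈ K,
      f t x + ⟪gradient (f t) x, y - x⟫ + βf / 2 * ‖x - y‖ ^ 2 ≤ f t y)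
    {xstar : ℕ → EuclideanSpace ℝ (Fin d)}
    (hxstarK : ∀ t ∈ Finset.Icc 1 T, xstar t ∈ K)
    (hxstar : ∀ t ∈ Finset.Icc 1 T, ∀ u ∈ K, f t (xstar t) ≤ f t u)
    {x v : ℕ → EuclideanSpace ℝ (Fin d)} (hx1 : x 1 ∈ K)
    (hvK : ∀ t ∈ Finset.Icc 1 (T - 1), v t ∈ K)
    (hv : ∀ t ∈ Finset.Icc 1 (T - 1), ∀ u ∈ K,
      ⟪gradient (f t) (x t), v t⟫ ≤ ⟪gradient (f t) (x t), u⟫)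
    {σ : ℕ → ℝ} (hσ : ∀ t ∈ Finset.Icc 1 (T - 1), σ t ∈ Set.Icc (0 : ℝ) 1)
    (hls : ∀ t ∈ Finset.Icc 1 (T - 1), ∀ σ' ∈ Set.Icc (0 : ℝ) 1,
      σ t * ⟪gradient (f t) (x t), v t - x t⟫
          + α * (σ t) ^ 2 / 2 * ‖x t - v t‖ ^ 2 ≤
        σ' * ⟪gradient (f t) (x t), v t - x t⟫
          + α * σ' ^ 2 / 2 * ‖x t - v t‖ ^ 2)
    (hupd : ∀ t ∈ Finset.Icc 1 (T - 1), x (t + 1) = (1 - σ t) • x t + σ t • v t)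
    {M : ℝ} (hMbound : ∀ t ∈ Finset.Icc 1 T, ∀ u ∈ K, 2 * |f t u| ≤ M)
    {δ : ℕ → ℝ}
    (hδ : ∀ t ∈ Finset.Icc 2 T, ∀ u ∈ K, |f t u - f (t - 1) u| ≤ δ t) :
    ∑ t ∈ Finset.Icc 1 T, f t (x t) - ∑ t ∈ Finset.Icc 1 T, f t (xstar t) ≤
      (8 * Real.sqrt 2 * α / (Real.sqrt βf * βK)
          * (M + ∑ t ∈ Finset.Icc 2 T, δ t)) ^ ((2 : ℝ) / 3) * (T : ℝ) ^ ((1 : ℝ) / 3)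
        + 2 * (M + ∑ t ∈ Finset.Icc 2 T, δ t) := by
  have hxK : ∀ n, n + 1 ≤ T → x (n + 1) ∈ K := by
    intro n
    induction n with
    | zero => exact fun _ => hx1
    | succ n ih =>
      intro hn
      have ht : n + 1 ∈ Finset.Icc 1 (T - 1) := Finset.mem_Icc.2 ⟨by omega, by omega⟩
      rw [hupd _ ht]
      exact hKconv (ih (by omega)) (hvK _ ht) (sub_nonneg.2 (hσ _ ht).2) (hσ _ ht).1 (by ring)
  have hxK' : ∀ t ∈ Finset.Icc 1 T, x t ∈ K := fun t ht => by
    obtain ⟨h1, h2⟩ := Finset.mem_Icc.1 ht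
    simpa [Nat.sub_add_cancel h1] using hxK (t - 1) (by omega)
  set h : ℕ → ℝ := fun t => f t (x t) - f t (xstar t) with hh
  set c : ℝ := βK * (√2 * √βf) / (8 * α) with hc
  have hc0 : 0 < c := by positivity
  have hnn : ∀ t ∈ Finset.Icc 1 T, 0 ≤ h t := fun t ht =>
    sub_nonneg.2 (hxstar t ht _ (hxK' t ht))
  have hstep : ∀ t ∈ Finset.Icc 1 (T - 1),
      min (h t / 2) (c * (h t * √(h t))) ≤ f t (x t) - f t (x (t + 1)) := fun t ht => by
    obtain ⟨h1, h2⟩ := Finset.mem_Icc.1 ht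
    have htT : t ∈ Finset.Icc 1 T := Finset.mem_Icc.2 ⟨h1, by omega⟩
    have hxt := hxK' t htT
    have hst := hxstarK t htT
    refine min_le_sub_of_line_search (g := gradient (f t) (x t)) hα hβK hβf
      (norm_mul_sq_le_inner_of_stronglyConvex_set hKsc hxt (hvK t ht) (hv t ht))
      (hxstar t htT _ hxt) (hv t ht _ hst) (hfsc t htT _ hxt _ hst) ?_ (hls t ht)
    have hsm := hfsmooth t htT _ hxt _ (hxK' (t + 1) (Finset.mem_Icc.2 ⟨by omega, by omega⟩))
    have e : x (t + 1) - x t = σ t • (v t - x t) := by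
      rw [hupd t ht]
      module
    rw [norm_sub_rev, e, inner_smul_right, norm_smul, mul_pow, Real.norm_eq_abs, sq_abs,
      norm_sub_rev (v t)] at hsm
    linarith
  have htel : ∀ n, n + 1 ≤ T →
      ∑ t ∈ Finset.Icc 1 n, min (h t / 2) (c * (h t * √(h t))) ≤
        f 1 (x 1) - f (n + 1) (x (n + 1)) + ∑ t ∈ Finset.Icc 2 (n + 1), δ t := by
    intro n
    induction n with
    | zero => simp
    | succ n ih =>
      intro hn
      rw [Finset.sum_Icc_succ_top (by omega), Finset.sum_Icc_succ_top (by omega)]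
      have h1 := hstep (n + 1) (Finset.mem_Icc.2 ⟨by omega, by omega⟩)
      have h2 := abs_le.1 (hδ (n + 1 + 1) (Finset.mem_Icc.2 ⟨by omega, by omega⟩) _
        (hxK (n + 1) hn))
      simp only [Nat.add_sub_cancel] at h2
      linarith [ih (by omega), h2.2]
  set S := M + ∑ t ∈ Finset.Icc 2 T, δ t with hS
  have hmin : ∑ t ∈ Finset.Icc 1 T, min (h t / 2) (c * (h t * √(h t))) ≤ S := by
    obtain ⟨n, rfl⟩ : ∃ n, T = n + 1 := ⟨T - 1, by omega⟩
    have hT' : n + 1 ∈ Finset.Icc 1 (n + 1) := Finset.mem_Icc.2 ⟨hT, le_rfl⟩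
    rw [Finset.sum_Icc_succ_top (by omega)]
    have h1 := htel n le_rfl
    have h2 := min_le_left (h (n + 1) / 2) (c * (h (n + 1) * √(h (n + 1))))
    have h3 := le_abs_self (f 1 (x 1))
    have h4 := neg_abs_le (f (n + 1) (x (n + 1)))
    have h5 := neg_abs_le (f (n + 1) (xstar (n + 1)))
    have h6 := hMbound 1 (Finset.mem_Icc.2 ⟨le_rfl, hT⟩) _ hx1
    have h7 := hMbound _ hT' _ (hxK' _ hT')
    have h8 := hMbound _ hT' _ (hxstarK _ hT')
    simp only [hh] at h1 h2 ⊢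
    linarith
  have hS0 : 0 ≤ S := by
    refine le_trans (Finset.sum_nonneg fun t ht => ?_) hmin
    have := hnn t ht
    exact le_min (by positivity) (by positivity)
  have hcoef : S / c ≤ 8 * √2 * α / (√βf * βK) * S := by
    have e : 8 * √2 * α / (√βf * βK) = 2 / c := by
      rw [hc, div_eq_div_iff (by positivity) (by positivity)]
      field_simp
      rw [Real.sq_sqrt (by norm_num)]
    rw [e, div_mul_eq_mul_div]
    gcongr
    linarith
  rw [← Finset.sum_sub_distrib]
  refine (sum_le_of_sum_min_le _ hc0 hnn hmin).trans ?_
  rw [Nat.card_Icc, Nat.add_sub_cancel]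
  gcongr
end

section
/- Let f, g : ℝ^d → ℝ be differentiable functions such that f is convex on K, α-smooth on K, and β_f-strongly convex on K. Let x⋆ ∈ K be a minimizer of f over K such that the closed Euclidean ball of radius r > 0 around x⋆ is contained in K, and let y⋆ ∈ K be a minimizer of g over K. Let M > 0 satisfy 2|f(u)| ≤ M for all u ∈ K, and set r̃ = min{r, √2·αD²/√(β_f·M)} and C = 1 − β_f·r̃²/(4αD²). Let x ∈ K, let v ∈ K be a linear-optimization step at x for f, let σ_t ∈ [0,1] be a line-search step size at (x, v) for f, and set x' = (1−σ_t)x + σ_t v. Let δ be a real number with |g(u) − f(u)| ≤ δ for all u ∈ K. Then g(x') − g(y⋆) ≤ δ + C·(f(x) − f(x⋆)) + f(x⋆) − g(y⋆). -/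
open RealInnerProductSpace

/-- Minimizing `-σ p + L σ² / 2` over `σ ∈ [0, 1]`: any amount below both `p² / (2 L)` and `L / 2`
is attained as a decrease. -/
theorem exists_mem_Icc_neg_mul_add_sq_le {p L c : ℝ} (hL : 0 < L) (hp : 0 ≤ p)
    (hc₁ : c ≤ p ^ 2 / (2 * L)) (hc₂ : c ≤ L / 2) :
    ∃ σ ∈ Set.Icc (0 : ℝ) 1, -(σ * p) + L * σ ^ 2 / 2 ≤ -c := by
  rcases le_total p L with h | h
  · refine ⟨p / L, ⟨by positivity, (div_le_one hL).2 h⟩, ?_⟩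
    have : -(p / L * p) + L * (p / L) ^ 2 / 2 = -(p ^ 2 / (2 * L)) := by
      field_simp
      ring
    linarith
  · exact ⟨1, ⟨zero_le_one, le_rfl⟩, by linarith⟩

/-- If `w` minimizes `⟪a, ·⟫` over a set containing the closed ball of radius `r` around `z`, then
`⟪a, w⟫` lies below `⟪a, z⟫` by at least `r * ‖a‖`. -/
theorem inner_le_inner_sub_mul_norm {E : Type*} [NormedAddCommGroup E] [InnerProductSpace ℝ E]
    {K : Set E} {a w z : E} {r : ℝ} (hr : 0 ≤ r) (hball : Metric.closedBall z r ⊆ K)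
    (hw : ∀ u ∈ K, ⟪a, w⟫ ≤ ⟪a, u⟫) : ⟪a, w⟫ ≤ ⟪a, z⟫ - r * ‖a‖ := by
  rcases eq_or_ne a 0 with rfl | ha
  · simp
  have hn : ‖a‖ ≠ 0 := norm_ne_zero_iff.2 ha
  have hmem : z - (r / ‖a‖) • a ∈ K := by
    refine hball ?_
    rw [Metric.mem_closedBall, dist_eq_norm, sub_sub_cancel_left, norm_neg, norm_smul,
      Real.norm_of_nonneg (by positivity), div_mul_cancel₀ _ hn]
  have h := hw _ hmem
  have hr' : r / ‖a‖ * ‖a‖ ^ 2 = r * ‖a‖ := by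
    field_simp
  rwa [inner_sub_right, real_inner_smul_right, real_inner_self_eq_norm_sq, hr'] at h

/-- A lower quadratic bound gives the Polyak-Łojasiewicz inequality. -/
theorem two_mul_mul_le_norm_sq {E : Type*} [NormedAddCommGroup E] [InnerProductSpace ℝ E]
    {a w : E} {β h : ℝ} (hβ : 0 < β) (hh : h + ⟪a, w⟫ + β / 2 * ‖w‖ ^ 2 ≤ 0) :
    2 * β * h ≤ ‖a‖ ^ 2 := by
  have hcs : -(‖a‖ * ‖w‖) ≤ ⟪a, w⟫ := neg_le_of_abs_le (abs_real_inner_le_norm a w)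
  have : h ≤ ‖a‖ * ‖w‖ - β / 2 * ‖w‖ ^ 2 := by linarith
  nlinarith [sq_nonneg (‖a‖ - β * ‖w‖), mul_le_mul_of_nonneg_left this hβ.le]

/-- Lemma 6: one OFW step with line search, strongly convex function
whose minimizer lies in the interior of the set. -/
theorem ofw_one_step_line_search_interior_minimizer
    {d : ℕ} {K : Set (EuclideanSpace ℝ (Fin d))}
    (hKne : K.Nonempty) (hKconv : Convex ℝ K)
    {D : ℝ} (hD : 0 < D) (hdiam : ∀ x ∈ K, ∀ y ∈ K, ‖x - y‖ ≤ D)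
    {α βf : ℝ} (hα : 0 < α) (hβf : 0 < βf)
    {f g : EuclideanSpace ℝ (Fin d) → ℝ}
    (hfdiff : Differentiable ℝ f) (hgdiff : Differentiable ℝ g)
    (hfconv : ConvexOn ℝ K f)
    (hfsmooth : ∀ x ∈ K, ∀ y ∈ K,
      f y ≤ f x + ⟪gradient f x, y - x⟫ + α / 2 * ‖x - y‖ ^ 2)
    (hfsc : ∀ x ∈ K, ∀ y ∈ K,
      f x + ⟪gradient f x, y - x⟫ + βf / 2 * ‖x - y‖ ^ 2 ≤ f y)
    {xstar ystar : EuclideanSpace ℝ (Fin d)}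
    (hxstarK : xstar ∈ K) (hxstar : ∀ u ∈ K, f xstar ≤ f u)
    {r : ℝ} (hr : 0 < r) (hball : Metric.closedBall xstar r ⊆ K)
    (hystarK : ystar ∈ K) (hystar : ∀ u ∈ K, g ystar ≤ g u)
    {M : ℝ} (hM : 0 < M) (hMbound : ∀ u ∈ K, 2 * |f u| ≤ M)
    {rtilde C : ℝ}
    (hrtilde : rtilde = min r (Real.sqrt 2 * α * D ^ 2 / Real.sqrt (βf * M)))
    (hC : C = 1 - βf * rtilde ^ 2 / (4 * α * D ^ 2))
    {x v : EuclideanSpace ℝ (Fin d)} (hxK : x ∈ K) (hvK : v ∈ K)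
    (hv : ∀ u ∈ K, ⟪gradient f x, v⟫ ≤ ⟪gradient f x, u⟫)
    {σt : ℝ} (hσt : σt ∈ Set.Icc (0 : ℝ) 1)
    (hls : ∀ σ' ∈ Set.Icc (0 : ℝ) 1,
      σt * ⟪gradient f x, v - x⟫ + α * σt ^ 2 / 2 * ‖x - v‖ ^ 2 ≤
        σ' * ⟪gradient f x, v - x⟫ + α * σ' ^ 2 / 2 * ‖x - v‖ ^ 2)
    {x' : EuclideanSpace ℝ (Fin d)} (hx' : x' = (1 - σt) • x + σt • v)
    {δ : ℝ} (hδ : ∀ u ∈ K, |g u - f u| ≤ δ) :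
    g x' - g ystar ≤ δ + C * (f x - f xstar) + f xstar - g ystar := by
  have hx'K : x' ∈ K := by
    rw [hx']
    exact hKconv hxK hvK (sub_nonneg.2 hσt.2) hσt.1 (by ring)
  have hstep : x' - x = σt • (v - x) := by
    rw [hx']
    module
  have hh0 : 0 ≤ f x - f xstar := sub_nonneg.2 (hxstar x hxK)
  have hhM : f x - f xstar ≤ M := by
    linarith [hMbound x hxK, hMbound _ hxstarK, le_abs_self (f x), neg_abs_le (f xstar)]
  have hsc := hfsc x hxK xstar hxstarK
  have hpl : 2 * βf * (f x - f xstar) ≤ ‖gradient f x‖ ^ 2 :=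
    two_mul_mul_le_norm_sq (w := xstar - x) hβf (by rw [norm_sub_rev xstar x]; linarith)
  have hgap : r * ‖gradient f x‖ ≤ -⟪gradient f x, v - x⟫ := by
    have h := inner_le_inner_sub_mul_norm hr.le hball hv
    have hs : 0 ≤ βf / 2 * ‖x - xstar‖ ^ 2 := by positivity
    rw [inner_sub_right] at hsc ⊢
    linarith
  have hL : 0 < α * D ^ 2 := by positivity
  have hrt0 : 0 ≤ rtilde := hrtilde ▸ le_min hr.le (by positivity)
  have hrtr : rtilde ≤ r := hrtilde ▸ min_le_left _ _
  have hrtM : βf * M * rtilde ^ 2 ≤ 2 * (α * D ^ 2) ^ 2 := by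
    have h : rtilde * √(βf * M) ≤ √2 * α * D ^ 2 :=
      (le_div_iff₀ (by positivity)).1 (hrtilde ▸ min_le_right _ _)
    have h2 := pow_le_pow_left₀ (by positivity) h 2
    rw [mul_pow, Real.sq_sqrt (by positivity), mul_assoc √2, mul_pow √2,
      Real.sq_sqrt zero_le_two] at h2
    linarith
  have hp0 : 0 ≤ -⟪gradient f x, v - x⟫ := le_trans (by positivity) hgap
  have hp2 : 2 * βf * (f x - f xstar) * rtilde ^ 2 ≤ (-⟪gradient f x, v - x⟫) ^ 2 :=
    calc 2 * βf * (f x - f xstar) * rtilde ^ 2 ≤ ‖gradient f x‖ ^ 2 * r ^ 2 := by gcongr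
      _ = (r * ‖gradient f x‖) ^ 2 := by ring
      _ ≤ _ := by gcongr
  have hnn : 0 ≤ βf * (f x - f xstar) * rtilde ^ 2 := by positivity
  obtain ⟨σ, hσ, hdec⟩ := exists_mem_Icc_neg_mul_add_sq_le
    (c := βf * rtilde ^ 2 / (4 * α * D ^ 2) * (f x - f xstar)) hL hp0
    (by
      rw [div_mul_eq_mul_div, div_le_div_iff₀ (by positivity) (by positivity)]
      nlinarith)
    (by
      have : βf * rtilde ^ 2 * (f x - f xstar) ≤ βf * rtilde ^ 2 * M := by gcongr
      rw [div_mul_eq_mul_div, div_le_div_iff₀ (by positivity) (by positivity)]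
      nlinarith)
  have hsm := hfsmooth x hxK x' hx'K
  rw [norm_sub_rev x x', hstep, real_inner_smul_right, norm_smul, mul_pow, Real.norm_eq_abs,
    sq_abs, norm_sub_rev v x] at hsm
  have hD2 : α * σ ^ 2 / 2 * ‖x - v‖ ^ 2 ≤ α * σ ^ 2 / 2 * D ^ 2 := by
    gcongr
    exact hdiam x hxK v hvK
  have hg := (abs_le.1 (hδ x' hx'K)).2
  have hf : f x' - f xstar ≤ C * (f x - f xstar) := by
    rw [hC]
    linarith [hls σ hσ]
  linarith
end

section
/- Let f_1, …, f_T : ℝ^d → ℝ be differentiable functions, each convex on K, α-smooth on K, and β_f-strongly convex on K with β_f < 4α; for each t let x_t⋆ ∈ K be a minimizer of f_t over K such that the closed Euclidean ball of radius r > 0 around x_t⋆ is contained in K. Let M > 0 satisfy 2|f_t(u)| ≤ M for all t and all u ∈ K, set r̃ = min{r, √2·αD²/√(β_f·M)}, C = 1 − β_f·r̃²/(4αD²) (assume 0 < C < 1), and N = ⌈ln(β_f/(4α))/ln C⌉. Run online Frank–Wolfe with N inner updates per round: x_1 ∈ K, and for each t = 1, …, T−1 set z_t^0 = x_t and, for i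 = 0, …, N−1, let v_t^i ∈ K be a linear-optimization step at z_t^i for f_t, let σ_t^i ∈ [0,1] be a line-search step size at (z_t^i, v_t^i) for f_t, and set z_t^{i+1} = (1−σ_t^i)z_t^i + σ_t^i v_t^i; finally set x_{t+1} = z_t^N. Let G satisfy ‖∇f_t(x_t)‖ ≤ G for all t, let δ_2, …, δ_T be reals with |f_t(u) − f_{t−1}(u)| ≤ δ_t for all u ∈ K, and set V_T = Σ_{t=2}^T δ_t, P_T⋆ = Σ_{t=2}^T ‖x_t⋆ − x_{t−1}⋆‖, and S_T⋆ = Σ_{t=2}^T ‖x_t⋆ − x_{t−1}⋆‖². Then Σ_{t=1}^T f_t(x_t) − Σ_{t=1}^T f_t(x_t⋆) ≤ min{4α(M + V_T)/(4α − β_f), 2GD + 2G·P_T⋆, αD² + 2α·S_T⋆}. -/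
open RealInnerProductSpace Finset

theorem one_sub_mul_sum_Icc_le_of_recurrence {T : ℕ} (hT : 1 ≤ T) {a b : ℕ → ℝ} {q : ℝ}
    (hrec : ∀ t ∈ Finset.Icc 1 (T - 1), a (t + 1) ≤ q * a t + b (t + 1)) :
    (1 - q) * ∑ t ∈ Finset.Icc 1 T, a t + q * a T ≤ a 1 + ∑ t ∈ Finset.Icc 2 T, b t := by
  induction T, hT using Nat.le_induction with
  | base => simp only [Finset.Icc_self, Finset.sum_singleton]; norm_num; linarith
  | succ n hn ih =>
    have h1 := ih fun t ht => hrec t (by simp only [Finset.mem_Icc] at *; omega)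
    have h2 := hrec n (by simp only [Finset.mem_Icc]; omega)
    rw [Finset.sum_Icc_succ_top (by omega), Finset.sum_Icc_succ_top (by omega)]
    linarith

theorem sum_Icc_two_sub_pred {T : ℕ} (hT : 1 ≤ T) (g : ℕ → ℝ) :
    ∑ t ∈ Finset.Icc 2 T, (g (t - 1) - g t) = g 1 - g T := by
  induction T, hT using Nat.le_induction with
  | base => simp
  | succ n hn ih =>
    rw [Finset.sum_Icc_succ_top (by omega), ih, Nat.add_sub_cancel]
    ring

theorem pow_natCeil_log_div_log_le {C ρ : ℝ} (hC0 : 0 < C) (hC1 : C < 1) (hρ : 0 < ρ) :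
    C ^ ⌈Real.log ρ / Real.log C⌉₊ ≤ ρ := by
  have hlog : Real.log C < 0 := Real.log_neg hC0 hC1
  have h := Nat.le_ceil (Real.log ρ / Real.log C)
  rw [div_le_iff_of_neg hlog] at h
  rw [← Real.log_le_log_iff (pow_pos hC0 _) hρ, Real.log_pow]
  exact h

section FrankWolfe

variable {E : Type*} [NormedAddCommGroup E] [InnerProductSpace ℝ E]

/-- A linear-optimization step over a set containing a ball of radius `r` around `y` improves on
`y` by at least `r * ‖g‖`. -/
theorem inner_sub_le_of_closedBall_subset {K : Set E} {g v y z : E} {r : ℝ} (hr : 0 ≤ r)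
    (hball : Metric.closedBall y r ⊆ K) (hv : ∀ u ∈ K, ⟪g, v⟫ ≤ ⟪g, u⟫) :
    ⟪g, v - z⟫ ≤ ⟪g, y - z⟫ - r * ‖g‖ := by
  have hmem : y - (r / ‖g‖) • g ∈ K := by
    apply hball
    rw [Metric.mem_closedBall, dist_eq_norm, sub_sub_cancel_left, norm_neg, norm_smul,
      Real.norm_of_nonneg (by positivity)]
    rcases eq_or_ne ‖g‖ 0 with h | h
    · simpa [h] using hr
    · rw [div_mul_cancel₀ _ h]
  have h := hv _ hmem
  rw [inner_sub_right, inner_smul_right, real_inner_self_eq_norm_sq] at h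
  have h2 : r / ‖g‖ * ‖g‖ ^ 2 = r * ‖g‖ := by
    rcases eq_or_ne ‖g‖ 0 with h | h
    · simp [h]
    · field_simp
  rw [inner_sub_right, inner_sub_right]
  linarith

theorem two_mul_le_norm_sq_of_strong_lower_bound {g w : E} {β h : ℝ} (hβ : 0 < β)
    (hsc : h + ⟪g, w⟫ + β / 2 * ‖w‖ ^ 2 ≤ 0) : 2 * β * h ≤ ‖g‖ ^ 2 := by
  have h1 := (abs_le.1 (abs_real_inner_le_norm g w)).1
  nlinarith [sq_nonneg (‖g‖ - β * ‖w‖)]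

/-- One line-search Frank–Wolfe step contracts the optimality gap when the minimizer is
interior. -/
theorem frankWolfe_gap_contraction {K : Set E} (hK : Convex ℝ K)
    {D : ℝ} (hD : 0 < D) (hdiam : ∀ x ∈ K, ∀ y ∈ K, ‖x - y‖ ≤ D)
    {α β : ℝ} (hα : 0 < α) (hβ : 0 < β) {f : E → ℝ} {f' : E → E}
    (hsmooth : ∀ x ∈ K, ∀ y ∈ K, f y ≤ f x + ⟪f' x, y - x⟫ + α / 2 * ‖x - y‖ ^ 2)
    (hsc : ∀ x ∈ K, ∀ y ∈ K, f x + ⟪f' x, y - x⟫ + β / 2 * ‖x - y‖ ^ 2 ≤ f y)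
    {y : E} (hyK : y ∈ K) (hy : ∀ u ∈ K, f y ≤ f u)
    {ρ M : ℝ} (hρ : 0 ≤ ρ) (hball : Metric.closedBall y ρ ⊆ K)
    (hM : ∀ u ∈ K, 2 * |f u| ≤ M) (hρM : ρ ^ 2 * (β * M) ≤ 2 * (α * D ^ 2) ^ 2)
    {z v : E} (hz : z ∈ K) (hvK : v ∈ K) (hv : ∀ u ∈ K, ⟪f' z, v⟫ ≤ ⟪f' z, u⟫)
    {σ : ℝ} (hσ : σ ∈ Set.Icc (0 : ℝ) 1)
    (hls : ∀ τ ∈ Set.Icc (0 : ℝ) 1,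
      σ * ⟪f' z, v - z⟫ + α * σ ^ 2 / 2 * ‖z - v‖ ^ 2 ≤
        τ * ⟪f' z, v - z⟫ + α * τ ^ 2 / 2 * ‖z - v‖ ^ 2) :
    f ((1 - σ) • z + σ • v) - f y ≤ (1 - β * ρ ^ 2 / (4 * α * D ^ 2)) * (f z - f y) := by
  have hgap : 0 ≤ f z - f y := sub_nonneg.2 (hy z hz)
  have hgapM : f z - f y ≤ M := by
    have h1 := hM z hz
    have h2 := hM y hyK
    have h3 := le_abs_self (f z)
    have h4 := neg_abs_le (f y)
    linarith
  set s := Real.sqrt (2 * β * (f z - f y)) with hs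
  have hs0 : 0 ≤ s := Real.sqrt_nonneg _
  have hs2 : s ^ 2 = 2 * β * (f z - f y) := Real.sq_sqrt (by positivity)
  have hscz := hsc z hz y hyK
  have hsg : s ≤ ‖f' z‖ := by
    apply Real.sqrt_le_iff.2 ⟨norm_nonneg _, ?_⟩
    apply two_mul_le_norm_sq_of_strong_lower_bound (w := y - z) hβ
    rw [norm_sub_rev y z]
    linarith
  have hdir : ⟪f' z, v - z⟫ ≤ -(ρ * s) := by
    have h1 := inner_sub_le_of_closedBall_subset (z := z) hρ hball hv
    have h2 := mul_le_mul_of_nonneg_left hsg hρ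
    have h3 : 0 ≤ β / 2 * ‖z - y‖ ^ 2 := by positivity
    linarith
  have hA : 0 < α * D ^ 2 := by positivity
  set τ := ρ * s / (2 * (α * D ^ 2)) with hτ
  have hτ0 : 0 ≤ τ := by positivity
  have hτ1 : τ ≤ 1 := by
    rw [hτ, div_le_one (by positivity)]
    refine abs_le_of_sq_le_sq' ?_ (by positivity) |>.2
    calc (ρ * s) ^ 2 = 2 * (ρ ^ 2 * (β * (f z - f y))) := by rw [mul_pow, hs2]; ring
      _ ≤ 2 * (ρ ^ 2 * (β * M)) := by gcongr
      _ ≤ _ := by linarith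
  have hτA : 2 * (α * D ^ 2) * τ = ρ * s := by rw [hτ]; field_simp
  have hstep := hls τ ⟨hτ0, hτ1⟩
  have hzK : (1 - σ) • z + σ • v ∈ K := hK hz hvK (by linarith [hσ.2]) hσ.1 (by ring)
  have hsm := hsmooth z hz _ hzK
  have e1 : (1 - σ) • z + σ • v - z = σ • (v - z) := by module
  rw [norm_sub_rev z, e1, inner_smul_right, norm_smul, mul_pow, Real.norm_eq_abs, sq_abs,
    norm_sub_rev v z] at hsm
  have hdD : ‖z - v‖ ^ 2 ≤ D ^ 2 := by gcongr; exact hdiam z hz v hvK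
  have h1 : τ * ⟪f' z, v - z⟫ ≤ τ * -(ρ * s) := mul_le_mul_of_nonneg_left hdir hτ0
  have h2 : α * τ ^ 2 / 2 * ‖z - v‖ ^ 2 ≤ α * τ ^ 2 / 2 * D ^ 2 := by gcongr
  have h3 : β * ρ ^ 2 / (4 * α * D ^ 2) * (f z - f y) = τ ^ 2 * (α * D ^ 2) / 2 := by
    rw [hτ, div_pow, mul_pow, hs2]
    field_simp
    ring
  have h4 : 0 ≤ τ ^ 2 * (α * D ^ 2) := by positivity
  rw [← hτA] at h1
  linarith

end FrankWolfe

/-- Theorem 5: dynamic regret of online Frank–Wolfe with multiple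
line-search updates per round, best-of-three-worlds bound. -/
theorem ofw_multiple_updates_dynamic_regret
    {d T : ℕ} (hT : 1 ≤ T) {K : Set (EuclideanSpace ℝ (Fin d))}
    (hKne : K.Nonempty) (hKconv : Convex ℝ K)
    {D : ℝ} (hD : 0 < D) (hdiam : ∀ x ∈ K, ∀ y ∈ K, ‖x - y‖ ≤ D)
    {α βf : ℝ} (hα : 0 < α) (hβf : 0 < βf) (hβfα : βf < 4 * α)
    {f : ℕ → EuclideanSpace ℝ (Fin d) → ℝ}
    (hfdiff : ∀ t ∈ Finset.Icc 1 T, Differentiable ℝ (f t))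
    (hfconv : ∀ t ∈ Finset.Icc 1 T, ConvexOn ℝ K (f t))
    (hfsmooth : ∀ t ∈ Finset.Icc 1 T, ∀ x ∈ K, ∀ y ∈ K,
      f t y ≤ f t x + ⟪gradient (f t) x, y - x⟫ + α / 2 * ‖x - y‖ ^ 2)
    (hfsc : ∀ t ∈ Finset.Icc 1 T, ∀ x ∈ K, ∀ y ∈ K,
      f t x + ⟪gradient (f t) x, y - x⟫ + βf / 2 * ‖x - y‖ ^ 2 ≤ f t y)
    {xstar : ℕ → EuclideanSpace ℝ (Fin d)}
    (hxstarK : ∀ t ∈ Finset.Icc 1 T, xstar t ∈ K)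
    (hxstar : ∀ t ∈ Finset.Icc 1 T, ∀ u ∈ K, f t (xstar t) ≤ f t u)
    {r : ℝ} (hr : 0 < r)
    (hball : ∀ t ∈ Finset.Icc 1 T, Metric.closedBall (xstar t) r ⊆ K)
    {M : ℝ} (hM : 0 < M) (hMbound : ∀ t ∈ Finset.Icc 1 T, ∀ u ∈ K, 2 * |f t u| ≤ M)
    {rtilde C : ℝ}
    (hrtilde : rtilde = min r (Real.sqrt 2 * α * D ^ 2 / Real.sqrt (βf * M)))
    (hC : C = 1 - βf * rtilde ^ 2 / (4 * α * D ^ 2)) (hC0 : 0 < C) (hC1 : C < 1)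
    {N : ℕ} (hN : N = ⌈Real.log (βf / (4 * α)) / Real.log C⌉₊)
    {x : ℕ → EuclideanSpace ℝ (Fin d)} (hx1 : x 1 ∈ K)
    {z v : ℕ → ℕ → EuclideanSpace ℝ (Fin d)} {σ : ℕ → ℕ → ℝ}
    (hz0 : ∀ t ∈ Finset.Icc 1 (T - 1), z t 0 = x t)
    (hvK : ∀ t ∈ Finset.Icc 1 (T - 1), ∀ i ∈ Finset.range N, v t i ∈ K)
    (hv : ∀ t ∈ Finset.Icc 1 (T - 1), ∀ i ∈ Finset.range N, ∀ u ∈ K,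
      ⟪gradient (f t) (z t i), v t i⟫ ≤ ⟪gradient (f t) (z t i), u⟫)
    (hσ : ∀ t ∈ Finset.Icc 1 (T - 1), ∀ i ∈ Finset.range N,
      σ t i ∈ Set.Icc (0 : ℝ) 1)
    (hls : ∀ t ∈ Finset.Icc 1 (T - 1), ∀ i ∈ Finset.range N,
      ∀ σ' ∈ Set.Icc (0 : ℝ) 1,
        σ t i * ⟪gradient (f t) (z t i), v t i - z t i⟫
            + α * (σ t i) ^ 2 / 2 * ‖z t i - v t i‖ ^ 2 ≤
          σ' * ⟪gradient (f t) (z t i), v t i - z t i⟫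
            + α * σ' ^ 2 / 2 * ‖z t i - v t i‖ ^ 2)
    (hupd : ∀ t ∈ Finset.Icc 1 (T - 1), ∀ i ∈ Finset.range N,
      z t (i + 1) = (1 - σ t i) • z t i + σ t i • v t i)
    (hxnext : ∀ t ∈ Finset.Icc 1 (T - 1), x (t + 1) = z t N)
    {G : ℝ} (hG : ∀ t ∈ Finset.Icc 1 T, ‖gradient (f t) (x t)‖ ≤ G)
    {δ : ℕ → ℝ}
    (hδ : ∀ t ∈ Finset.Icc 2 T, ∀ u ∈ K, |f t u - f (t - 1) u| ≤ δ t) :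
    ∑ t ∈ Finset.Icc 1 T, f t (x t) - ∑ t ∈ Finset.Icc 1 T, f t (xstar t) ≤
      min (4 * α * (M + ∑ t ∈ Finset.Icc 2 T, δ t) / (4 * α - βf))
        (min (2 * G * D + 2 * G * ∑ t ∈ Finset.Icc 2 T, ‖xstar t - xstar (t - 1)‖)
          (α * D ^ 2 + 2 * α * ∑ t ∈ Finset.Icc 2 T, ‖xstar t - xstar (t - 1)‖ ^ 2)) := by
  have hrt0 : 0 < rtilde := by
    rw [hrtilde]; exact lt_min hr (by positivity)
  have hrtr : rtilde ≤ r := hrtilde ▸ min_le_left _ _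
  have hrtM : rtilde ^ 2 * (βf * M) ≤ 2 * (α * D ^ 2) ^ 2 := by
    have h1 : rtilde ≤ Real.sqrt 2 * α * D ^ 2 / Real.sqrt (βf * M) := hrtilde ▸ min_le_right _ _
    rw [le_div_iff₀ (by positivity)] at h1
    have h2 := pow_le_pow_left₀ (by positivity) h1 2
    rw [mul_pow, Real.sq_sqrt (by positivity)] at h2
    calc _ ≤ _ := h2
      _ = (Real.sqrt 2) ^ 2 * (α * D ^ 2) ^ 2 := by ring
      _ = _ := by rw [Real.sq_sqrt (by norm_num)]
  have hCN : C ^ N ≤ βf / (4 * α) := hN ▸ pow_natCeil_log_div_log_le hC0 hC1 (by positivity)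
  have hmem : ∀ t ∈ Finset.Icc 1 (T - 1), t ∈ Finset.Icc 1 T ∧ t + 1 ∈ Finset.Icc 1 T ∧
      t + 1 ∈ Finset.Icc 2 T := by
    intro t ht
    simp only [Finset.mem_Icc] at *
    omega
  have hinner : ∀ t ∈ Finset.Icc 1 (T - 1), x t ∈ K → ∀ i ≤ N, z t i ∈ K ∧
      f t (z t i) - f t (xstar t) ≤ C ^ i * (f t (x t) - f t (xstar t)) := by
    intro t ht hxt i
    have htT := (hmem t ht).1
    induction i with
    | zero => intro _; rw [hz0 t ht]; exact ⟨hxt, by simp⟩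
    | succ i ih =>
      intro hi
      obtain ⟨hzi, hgap⟩ := ih (by omega)
      have hiN : i ∈ Finset.range N := Finset.mem_range.2 hi
      have hσi := hσ t ht i hiN
      have hvi := hvK t ht i hiN
      rw [hupd t ht i hiN]
      refine ⟨hKconv hzi hvi (by linarith [hσi.2]) hσi.1 (by ring), ?_⟩
      have hstep := frankWolfe_gap_contraction hKconv hD hdiam hα hβf (hfsmooth t htT)
        (hfsc t htT) (hxstarK t htT) (hxstar t htT) hrt0.le
        ((Metric.closedBall_subset_closedBall hrtr).trans (hball t htT)) (hMbound t htT) hrtM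
        hzi hvi (hv t ht i hiN) hσi (hls t ht i hiN)
      rw [← hC] at hstep
      calc _ ≤ _ := hstep
        _ ≤ C * (C ^ i * (f t (x t) - f t (xstar t))) := by gcongr
        _ = _ := by ring
  have hxK : ∀ t ∈ Finset.Icc 1 T, x t ∈ K := by
    intro t ht
    obtain ⟨ht1, htT⟩ := Finset.mem_Icc.1 ht
    clear ht
    induction t, ht1 using Nat.le_induction with
    | base => exact hx1
    | succ n hn ih =>
      have hn' : n ∈ Finset.Icc 1 (T - 1) := Finset.mem_Icc.2 ⟨hn, by omega⟩
      rw [hxnext n hn']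
      exact (hinner n hn' (ih (by omega)) N le_rfl).1
  have ha0 : ∀ t ∈ Finset.Icc 1 T, 0 ≤ f t (x t) - f t (xstar t) := fun t ht =>
    sub_nonneg.2 (hxstar t ht _ (hxK t ht))
  have hround : ∀ t ∈ Finset.Icc 1 (T - 1), f t (x (t + 1)) - f t (xstar t) ≤
      βf / (4 * α) * (f t (x t) - f t (xstar t)) := by
    intro t ht
    have htT := (hmem t ht).1
    rw [hxnext t ht]
    exact (hinner t ht (hxK t htT) N le_rfl).2.trans
      (mul_le_mul_of_nonneg_right hCN (ha0 t htT))
  have hgrad : ∀ t ∈ Finset.Icc 1 T, gradient (f t) (xstar t) = 0 := by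
    intro t ht
    have hmin : IsLocalMin (f t) (xstar t) := by
      filter_upwards [Metric.closedBall_mem_nhds (xstar t) hr] with u hu
      exact hxstar t ht u (hball t ht hu)
    simp [gradient, hmin.fderiv_eq_zero]
  have hupper : ∀ t ∈ Finset.Icc 1 T,
      f t (x t) - f t (xstar t) ≤ α / 2 * ‖x t - xstar t‖ ^ 2 := by
    intro t ht
    have h := hfsmooth t ht _ (hxstarK t ht) _ (hxK t ht)
    rw [hgrad t ht, inner_zero_left, norm_sub_rev] at h
    linarith
  have hhalf : ∀ t ∈ Finset.Icc 1 (T - 1), ‖x (t + 1) - xstar t‖ ≤ 1 / 2 * ‖x t - xstar t‖ := by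
    intro t ht
    obtain ⟨htT, htT', -⟩ := hmem t ht
    have h := hfsc t htT _ (hxstarK t htT) _ (hxK _ htT')
    rw [hgrad t htT, inner_zero_left, norm_sub_rev] at h
    have h2 := mul_le_mul_of_nonneg_left (hupper t htT) (show 0 ≤ βf / (4 * α) by positivity)
    have h3 : βf / (4 * α) * (α / 2 * ‖x t - xstar t‖ ^ 2) = βf * (‖x t - xstar t‖ ^ 2 / 8) := by
      field_simp
      ring
    have h4 : βf * (‖x (t + 1) - xstar t‖ ^ 2 / 2) ≤ βf * (‖x t - xstar t‖ ^ 2 / 8) := by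
      linarith [hround t ht]
    have h5 := le_of_mul_le_mul_left h4 hβf
    refine abs_le_of_sq_le_sq' ?_ (by positivity) |>.2
    linarith
  have hdist : ∀ t ∈ Finset.Icc 1 (T - 1), ‖x (t + 1) - xstar (t + 1)‖ ≤
      1 / 2 * ‖x t - xstar t‖ + ‖xstar (t + 1) - xstar (t + 1 - 1)‖ := by
    intro t ht
    have h := norm_sub_le_norm_sub_add_norm_sub (x (t + 1)) (xstar t) (xstar (t + 1))
    rw [norm_sub_rev (xstar t)] at h
    rw [Nat.add_sub_cancel]
    linarith [hhalf t ht]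
  have h1T : 1 ∈ Finset.Icc 1 T := Finset.mem_Icc.2 ⟨le_rfl, hT⟩
  have hTT : T ∈ Finset.Icc 1 T := Finset.mem_Icc.2 ⟨hT, le_rfl⟩
  have hd1 : ‖x 1 - xstar 1‖ ≤ D := hdiam _ hx1 _ (hxstarK 1 h1T)
  rw [← Finset.sum_sub_distrib]
  refine le_min ?_ (le_min ?_ ?_)
  · have hrec := one_sub_mul_sum_Icc_le_of_recurrence hT (q := βf / (4 * α))
      (a := fun t => f t (x t) - f t (xstar t))
      (b := fun t => δ t + (f (t - 1) (xstar (t - 1)) - f t (xstar t))) (by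
        intro t ht
        obtain ⟨-, htT', ht2⟩ := hmem t ht
        have h := (abs_le.1 (hδ (t + 1) ht2 _ (hxK _ htT'))).2
        simp only [Nat.add_sub_cancel] at h ⊢
        linarith [hround t ht])
    rw [Finset.sum_add_distrib, sum_Icc_two_sub_pred hT fun t => f t (xstar t)] at hrec
    have h1 := hMbound 1 h1T _ hx1
    have h2 := hMbound T hTT _ (hxstarK T hTT)
    have h3 := le_abs_self (f 1 (x 1))
    have h4 := neg_abs_le (f T (xstar T))
    have h5 : 0 ≤ βf / (4 * α) * (f T (x T) - f T (xstar T)) :=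
      mul_nonneg (by positivity) (ha0 T hTT)
    have h6 : (1 - βf / (4 * α)) * ∑ t ∈ Finset.Icc 1 T, (f t (x t) - f t (xstar t)) ≤
        M + ∑ t ∈ Finset.Icc 2 T, δ t := by linarith
    have h7 : 1 - βf / (4 * α) = (4 * α - βf) / (4 * α) := by field_simp
    rw [h7, div_mul_eq_mul_div, div_le_iff₀ (by positivity)] at h6
    rw [le_div_iff₀ (by linarith)]
    linarith
  · have hrec := one_sub_mul_sum_Icc_le_of_recurrence hT (q := 1 / 2)
      (a := fun t => ‖x t - xstar t‖) (b := fun t => ‖xstar t - xstar (t - 1)‖) hdist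
    have hG0 : 0 ≤ G := (norm_nonneg _).trans (hG 1 h1T)
    have hlin : ∀ t ∈ Finset.Icc 1 T, f t (x t) - f t (xstar t) ≤ G * ‖x t - xstar t‖ := by
      intro t ht
      have h1 := hfsc t ht _ (hxK t ht) _ (hxstarK t ht)
      have h2 := (abs_le.1 (abs_real_inner_le_norm (gradient (f t) (x t)) (xstar t - x t))).1
      have h3 := mul_le_mul_of_nonneg_right (hG t ht) (norm_nonneg (xstar t - x t))
      have h4 : 0 ≤ βf / 2 * ‖x t - xstar t‖ ^ 2 := by positivity
      rw [norm_sub_rev (x t)] at h1 h4 ⊢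
      linarith
    calc _ ≤ ∑ t ∈ Finset.Icc 1 T, G * ‖x t - xstar t‖ := Finset.sum_le_sum hlin
      _ = G * ∑ t ∈ Finset.Icc 1 T, ‖x t - xstar t‖ := by rw [Finset.mul_sum]
      _ ≤ G * (2 * D + 2 * ∑ t ∈ Finset.Icc 2 T, ‖xstar t - xstar (t - 1)‖) := by
        apply mul_le_mul_of_nonneg_left _ hG0
        linarith [norm_nonneg (x T - xstar T)]
      _ = _ := by ring
  · have hrec := one_sub_mul_sum_Icc_le_of_recurrence hT (q := 1 / 2)
      (a := fun t => ‖x t - xstar t‖ ^ 2) (b := fun t => 2 * ‖xstar t - xstar (t - 1)‖ ^ 2) (by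
        intro t ht
        have h := pow_le_pow_left₀ (norm_nonneg _) (hdist t ht) 2
        linarith [sq_nonneg (1 / 2 * ‖x t - xstar t‖ - ‖xstar (t + 1) - xstar (t + 1 - 1)‖)])
    rw [← Finset.mul_sum] at hrec
    have hd1sq := pow_le_pow_left₀ (norm_nonneg _) hd1 2
    calc _ ≤ ∑ t ∈ Finset.Icc 1 T, α / 2 * ‖x t - xstar t‖ ^ 2 := Finset.sum_le_sum hupper
      _ = α / 2 * ∑ t ∈ Finset.Icc 1 T, ‖x t - xstar t‖ ^ 2 := by rw [Finset.mul_sum]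
      _ ≤ α / 2 * (2 * D ^ 2 + 4 * ∑ t ∈ Finset.Icc 2 T, ‖xstar t - xstar (t - 1)‖ ^ 2) := by
        apply mul_le_mul_of_nonneg_left _ (by positivity)
        linarith [sq_nonneg ‖x T - xstar T‖]
      _ = _ := by ring
end

section
/- Let f : ℝ^d → ℝ be differentiable, convex on K and α-smooth on K, and let x⋆ ∈ K be a minimizer of f over K. Let x ∈ K, let v ∈ K be a linear-optimization step at x for f, let σ_t ∈ [0,1] be a line-search step size at (x, v) for f, and set x' = (1−σ_t)x + σ_t v. Then for every σ ∈ [0,1], f(x') − f(x⋆) ≤ (1−σ)(f(x) − f(x⋆)) + ασ²D²/2. -/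
open RealInnerProductSpace

/-- First-order lower bound for a convex function on a set, at a point of differentiability. -/
theorem ConvexOn.inner_gradient_le_sub {E : Type*} [NormedAddCommGroup E]
    [InnerProductSpace ℝ E] [CompleteSpace E] {s : Set E} {f : E → ℝ} {x y : E}
    (hf : ConvexOn ℝ s f) (hx : x ∈ s) (hy : y ∈ s) (hd : DifferentiableAt ℝ f x) :
    ⟪gradient f x, y - x⟫ ≤ f y - f x := by
  have hconv := hf.comp_affineMap (AffineMap.lineMap x y : ℝ →ᵃ[ℝ] E)
  have hderiv : HasDerivAt (f ∘ (AffineMap.lineMap x y : ℝ →ᵃ[ℝ] E))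
      ⟪gradient f x, y - x⟫ 0 := by
    have hg : HasFDerivAt f (InnerProductSpace.toDual ℝ E (gradient f x))
        ((AffineMap.lineMap x y : ℝ →ᵃ[ℝ] E) 0) := by
      simpa using hd.hasGradientAt.hasFDerivAt
    simpa using hg.comp_hasDerivAt (0 : ℝ) AffineMap.hasDerivAt_lineMap
  simpa [slope_def_field] using
    hconv.le_slope_of_hasDerivAt (x := 0) (y := 1) (by simpa using hx) (by simpa using hy)
      one_pos hderiv

/-- one FW line-search step dominates every fixed step size,
smooth convex case. -/
theorem fw_line_search_step_bound
    {d : ℕ} {K : Set (EuclideanSpace ℝ (Fin d))}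
    (hKne : K.Nonempty) (hKconv : Convex ℝ K)
    {D : ℝ} (hD : 0 < D) (hdiam : ∀ x ∈ K, ∀ y ∈ K, ‖x - y‖ ≤ D)
    {α : ℝ} (hα : 0 < α)
    {f : EuclideanSpace ℝ (Fin d) → ℝ}
    (hfdiff : Differentiable ℝ f)
    (hfconv : ConvexOn ℝ K f)
    (hfsmooth : ∀ x ∈ K, ∀ y ∈ K,
      f y ≤ f x + ⟪gradient f x, y - x⟫ + α / 2 * ‖x - y‖ ^ 2)
    {xstar : EuclideanSpace ℝ (Fin d)}
    (hxstarK : xstar ∈ K) (hxstar : ∀ u ∈ K, f xstar ≤ f u)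
    {x v : EuclideanSpace ℝ (Fin d)} (hxK : x ∈ K) (hvK : v ∈ K)
    (hv : ∀ u ∈ K, ⟪gradient f x, v⟫ ≤ ⟪gradient f x, u⟫)
    {σt : ℝ} (hσt : σt ∈ Set.Icc (0 : ℝ) 1)
    (hls : ∀ σ' ∈ Set.Icc (0 : ℝ) 1,
      σt * ⟪gradient f x, v - x⟫ + α * σt ^ 2 / 2 * ‖x - v‖ ^ 2 ≤
        σ' * ⟪gradient f x, v - x⟫ + α * σ' ^ 2 / 2 * ‖x - v‖ ^ 2)
    {x' : EuclideanSpace ℝ (Fin d)} (hx' : x' = (1 - σt) • x + σt • v) :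
    ∀ σ ∈ Set.Icc (0 : ℝ) 1,
      f x' - f xstar ≤ (1 - σ) * (f x - f xstar) + α * σ ^ 2 * D ^ 2 / 2 := by
  rintro σ ⟨hσ0, hσ1⟩
  have hx'K : x' ∈ K := by
    rw [hx']
    exact hKconv hxK hvK (by linarith [hσt.2]) hσt.1 (by ring)
  have hdiff : x' - x = σt • (v - x) := by
    rw [hx']
    module
  have hnorm : ‖x - x'‖ ^ 2 = σt ^ 2 * ‖x - v‖ ^ 2 := by
    rw [norm_sub_rev, hdiff, norm_smul, mul_pow, Real.norm_eq_abs, sq_abs, norm_sub_rev v]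
  have hsmooth := hfsmooth x hxK x' hx'K
  rw [hnorm, hdiff, inner_smul_right] at hsmooth
  have hstep := hls σ ⟨hσ0, hσ1⟩
  have hlin : ⟪gradient f x, v - x⟫ ≤ f xstar - f x := by
    have hfirst := hfconv.inner_gradient_le_sub hxK hxstarK (hfdiff x)
    have hmin := hv xstar hxstarK
    rw [inner_sub_right] at hfirst ⊢
    linarith
  have hσlin := mul_le_mul_of_nonneg_left hlin hσ0
  have hsq : ‖x - v‖ ^ 2 ≤ D ^ 2 := by
    gcongr
    exact hdiam x hxK v hvK
  have hquad : α * σ ^ 2 / 2 * ‖x - v‖ ^ 2 ≤ α * σ ^ 2 / 2 * D ^ 2 := by gcongr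
  linarith
end

section
/- Let x_1, …, x_T and x_1⋆, …, x_T⋆ be points of ℝ^d with ‖x_1 − x_1⋆‖ ≤ D, and suppose ‖x_t − x_{t−1}⋆‖ ≤ (1/2)‖x_{t−1} − x_{t−1}⋆‖ for all t = 2, …, T. Then Σ_{t=1}^T ‖x_t − x_t⋆‖ ≤ 2D + 2·Σ_{t=2}^T ‖x_t⋆ − x_{t−1}⋆‖. -/
open Finset

/-- Potential-function form of the path-length bound: the last distance is counted twice. -/
theorem sum_dist_add_dist_le_path_length {E : Type*} [SeminormedAddCommGroup E]
    {T : ℕ} (hT : 1 ≤ T) {D : ℝ} {x y : ℕ → E} (h1 : ‖x 1 - y 1‖ ≤ D)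
    (hcontr : ∀ t ∈ Finset.Icc 2 T, ‖x t - y (t - 1)‖ ≤ 1 / 2 * ‖x (t - 1) - y (t - 1)‖) :
    ∑ t ∈ Finset.Icc 1 T, ‖x t - y t‖ + ‖x T - y T‖ ≤
      2 * D + 2 * ∑ t ∈ Finset.Icc 2 T, ‖y t - y (t - 1)‖ := by
  induction T, hT using Nat.le_induction with
  | base =>
    simp only [Icc_self, sum_singleton, Icc_eq_empty_of_lt one_lt_two, sum_empty]
    linarith
  | succ n hn ih =>
    have hprev := ih fun t ht => hcontr t (Icc_subset_Icc_right n.le_succ ht)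
    have hstep := hcontr (n + 1) (mem_Icc.2 ⟨by omega, le_rfl⟩)
    have htri := norm_sub_le_norm_sub_add_norm_sub (x (n + 1)) (y n) (y (n + 1))
    rw [norm_sub_rev (y n)] at htri
    rw [sum_Icc_succ_top (by omega), sum_Icc_succ_top (by omega)]
    simp only [Nat.add_sub_cancel] at hstep ⊢
    linarith

/-- path-length bound for a contracting sequence. -/
theorem sum_dist_le_path_length
    {d T : ℕ} (hT : 1 ≤ T) {D : ℝ} (hD : 0 < D)
    {x xstar : ℕ → EuclideanSpace ℝ (Fin d)}
    (h1 : ‖x 1 - xstar 1‖ ≤ D)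
    (hcontr : ∀ t ∈ Finset.Icc 2 T,
      ‖x t - xstar (t - 1)‖ ≤ 1 / 2 * ‖x (t - 1) - xstar (t - 1)‖) :
    ∑ t ∈ Finset.Icc 1 T, ‖x t - xstar t‖ ≤
      2 * D + 2 * ∑ t ∈ Finset.Icc 2 T, ‖xstar t - xstar (t - 1)‖ := by
  exact (le_add_of_nonneg_right (norm_nonneg _)).trans
    (sum_dist_add_dist_le_path_length hT h1 hcontr)
end

section
/- Let x_1, …, x_T and x_1⋆, …, x_T⋆ be points of ℝ^d with ‖x_1 − x_1⋆‖ ≤ D, and suppose ‖x_t − x_{t−1}⋆‖² ≤ (1/4)‖x_{t−1} − x_{t−1}⋆‖² for all t = 2, …, T. Then Σ_{t=1}^T ‖x_t − x_t⋆‖² ≤ 2D² + 4·Σ_{t=2}^T ‖x_t⋆ − x_{t−1}⋆‖². -/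
open Finset

/-- A real sequence with `a t ≤ a (t - 1) / 2 + 2 * s t` has its sum controlled by its
first term and the sum of `s`, with the last term to spare. -/
theorem sum_Icc_add_last_le_of_le_half_add {T : ℕ} (hT : 1 ≤ T) {a s : ℕ → ℝ}
    (h : ∀ t ∈ Finset.Icc 2 T, a t ≤ a (t - 1) / 2 + 2 * s t) :
    ∑ t ∈ Finset.Icc 1 T, a t + a T ≤ 2 * a 1 + 4 * ∑ t ∈ Finset.Icc 2 T, s t := by
  induction T, hT using Nat.le_induction with
  | base => simp [two_mul]
  | succ n hn ih =>
    have hlast := h (n + 1) (Finset.mem_Icc.2 ⟨by omega, le_rfl⟩)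
    have hprev := ih fun t ht =>
      h t (Finset.Icc_subset_Icc_right n.le_succ ht)
    rw [Finset.sum_Icc_succ_top (by omega), Finset.sum_Icc_succ_top (by omega)]
    rw [Nat.add_sub_cancel] at hlast
    linarith

/-- A bound on the square of the distance through an intermediate point. -/
theorem norm_sub_sq_le_two_mul_add {E : Type*} [SeminormedAddCommGroup E] (u v w : E) :
    ‖u - w‖ ^ 2 ≤ 2 * ‖u - v‖ ^ 2 + 2 * ‖w - v‖ ^ 2 := by
  have h := norm_sub_le_norm_sub_add_norm_sub u v w
  rw [norm_sub_rev v w] at h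
  nlinarith [norm_nonneg (u - w), sq_nonneg (‖u - v‖ - ‖w - v‖)]

/-- squared-path-length bound for a contracting sequence. -/
theorem sum_sq_dist_le_squared_path_length
    {d T : ℕ} (hT : 1 ≤ T) {D : ℝ} (hD : 0 < D)
    {x xstar : ℕ → EuclideanSpace ℝ (Fin d)}
    (h1 : ‖x 1 - xstar 1‖ ≤ D)
    (hcontr : ∀ t ∈ Finset.Icc 2 T,
      ‖x t - xstar (t - 1)‖ ^ 2 ≤ 1 / 4 * ‖x (t - 1) - xstar (t - 1)‖ ^ 2) :
    ∑ t ∈ Finset.Icc 1 T, ‖x t - xstar t‖ ^ 2 ≤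
      2 * D ^ 2 + 4 * ∑ t ∈ Finset.Icc 2 T, ‖xstar t - xstar (t - 1)‖ ^ 2 := by
  have hsum := sum_Icc_add_last_le_of_le_half_add hT (a := fun t => ‖x t - xstar t‖ ^ 2)
    (s := fun t => ‖xstar t - xstar (t - 1)‖ ^ 2) fun t ht => by
      linarith [hcontr t ht, norm_sub_sq_le_two_mul_add (x t) (xstar (t - 1)) (xstar t)]
  have hfirst : ‖x 1 - xstar 1‖ ^ 2 ≤ D ^ 2 := by gcongr
  linarith [sq_nonneg ‖x T - xstar T‖]
end

section
/- Let f : ℝ^d → ℝ be differentiable, convex on K, α-smooth on K, and β_f-strongly convex on K. Let x⋆ ∈ K be a minimizer of f over K such that the closed Euclidean ball of radius r > 0 around x⋆ is contained in K. Let z ∈ K, let v ∈ K be a linear-optimization step at z for f, let σ_t ∈ [0,1] be a line-search step size at (z, v) for f, and set z' = (1−σ_t)z + σ_t v. Then for every σ ∈ [0,1], f(z') − f(x⋆) ≤ f(z) − f(x⋆) − σ·r·√(β_f·(f(z) − f(x⋆))/2) + ασ²D²/2. -/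
open RealInnerProductSpace

/-- Over a set containing the closed ball of radius `r` around `x`, a linear minimizer `v` gains
at least `r * ‖g‖` over `x`. -/
theorem inner_le_inner_sub_of_closedBall_subset
    {E : Type*} [NormedAddCommGroup E] [InnerProductSpace ℝ E] {K : Set E} {x v g : E} {r : ℝ}
    (hr : 0 ≤ r) (hball : Metric.closedBall x r ⊆ K)
    (hv : ∀ u ∈ K, ⟪g, v⟫ ≤ ⟪g, u⟫) :
    ⟪g, v⟫ ≤ ⟪g, x⟫ - r * ‖g‖ := by
  rcases eq_or_ne g 0 with rfl | hg
  · simp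
  have hg' : ‖g‖ ≠ 0 := norm_ne_zero_iff.mpr hg
  have hmem : x - (r / ‖g‖) • g ∈ K := by
    apply hball
    rw [mem_closedBall_iff_norm, sub_sub_cancel_left, norm_neg, norm_smul, norm_div, norm_norm,
      Real.norm_of_nonneg hr, div_mul_cancel₀ _ hg']
  refine (hv _ hmem).trans_eq ?_
  rw [inner_sub_right, real_inner_smul_right, real_inner_self_eq_norm_sq]
  field_simp

/-- A strong-convexity lower bound with gradient `g` bounds the gap by `‖g‖ ^ 2 / (2 * β)`. -/
theorem two_mul_mul_le_norm_sq_of_le_neg_inner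
    {E : Type*} [NormedAddCommGroup E] [InnerProductSpace ℝ E] {g w : E} {β h : ℝ}
    (hβ : 0 ≤ β) (hh : h ≤ -⟪g, w⟫ - β / 2 * ‖w‖ ^ 2) :
    2 * β * h ≤ ‖g‖ ^ 2 := by
  have hcs : -⟪g, w⟫ ≤ ‖g‖ * ‖w‖ := (neg_le_abs _).trans (abs_real_inner_le_norm g w)
  have hmul := mul_le_mul_of_nonneg_left (hh.trans (sub_le_sub_right hcs _)) hβ
  nlinarith [sq_nonneg (‖g‖ - β * ‖w‖)]

/-- one FW line-search step for a strongly convex function whose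
minimizer has a ball of radius r inside the set. -/
theorem fw_line_search_step_interior_minimizer
    {d : ℕ} {K : Set (EuclideanSpace ℝ (Fin d))}
    (hKne : K.Nonempty) (hKconv : Convex ℝ K)
    {D : ℝ} (hD : 0 < D) (hdiam : ∀ x ∈ K, ∀ y ∈ K, ‖x - y‖ ≤ D)
    {α βf : ℝ} (hα : 0 < α) (hβf : 0 < βf)
    {f : EuclideanSpace ℝ (Fin d) → ℝ}
    (hfdiff : Differentiable ℝ f)
    (hfconv : ConvexOn ℝ K f)
    (hfsmooth : ∀ x ∈ K, ∀ y ∈ K,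
      f y ≤ f x + ⟪gradient f x, y - x⟫ + α / 2 * ‖x - y‖ ^ 2)
    (hfsc : ∀ x ∈ K, ∀ y ∈ K,
      f x + ⟪gradient f x, y - x⟫ + βf / 2 * ‖x - y‖ ^ 2 ≤ f y)
    {xstar : EuclideanSpace ℝ (Fin d)}
    (hxstarK : xstar ∈ K) (hxstar : ∀ u ∈ K, f xstar ≤ f u)
    {r : ℝ} (hr : 0 < r) (hball : Metric.closedBall xstar r ⊆ K)
    {z v : EuclideanSpace ℝ (Fin d)} (hzK : z ∈ K) (hvK : v ∈ K)
    (hv : ∀ u ∈ K, ⟪gradient f z, v⟫ ≤ ⟪gradient f z, u⟫)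
    {σt : ℝ} (hσt : σt ∈ Set.Icc (0 : ℝ) 1)
    (hls : ∀ σ' ∈ Set.Icc (0 : ℝ) 1,
      σt * ⟪gradient f z, v - z⟫ + α * σt ^ 2 / 2 * ‖z - v‖ ^ 2 ≤
        σ' * ⟪gradient f z, v - z⟫ + α * σ' ^ 2 / 2 * ‖z - v‖ ^ 2)
    {z' : EuclideanSpace ℝ (Fin d)} (hz' : z' = (1 - σt) • z + σt • v) :
    ∀ σ ∈ Set.Icc (0 : ℝ) 1,
      f z' - f xstar ≤
        f z - f xstar - σ * r * Real.sqrt (βf * (f z - f xstar) / 2)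
          + α * σ ^ 2 * D ^ 2 / 2 := by
  rintro σ ⟨hσ0, hσ1⟩
  have hgap : 0 ≤ f z - f xstar := sub_nonneg.mpr (hxstar z hzK)
  have hsc := hfsc z hzK xstar hxstarK
  rw [norm_sub_rev] at hsc
  have hgrad : 2 * βf * (f z - f xstar) ≤ ‖gradient f z‖ ^ 2 :=
    two_mul_mul_le_norm_sq_of_le_neg_inner (w := xstar - z) hβf.le (by linarith)
  have hsqrt : Real.sqrt (βf * (f z - f xstar) / 2) ≤ ‖gradient f z‖ :=
    Real.sqrt_le_iff.mpr ⟨norm_nonneg _, by nlinarith [mul_nonneg hβf.le hgap]⟩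
  have hlin := inner_le_inner_sub_of_closedBall_subset hr.le hball hv
  have hdir : ⟪gradient f z, v - z⟫ ≤ -(r * Real.sqrt (βf * (f z - f xstar) / 2)) := by
    have hquad : 0 ≤ βf / 2 * ‖xstar - z‖ ^ 2 := by positivity
    have hrs := mul_le_mul_of_nonneg_left hsqrt hr.le
    rw [inner_sub_right] at hsc ⊢
    linarith
  have hz'K : z' ∈ K := by
    rw [hz']
    exact hKconv hzK hvK (sub_nonneg.mpr hσt.2) hσt.1 (by ring)
  have hstep : z' - z = σt • (v - z) := by
    rw [hz']
    module
  have hsmooth := hfsmooth z hzK z' hz'K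
  rw [norm_sub_rev, hstep, real_inner_smul_right, norm_smul, mul_pow, Real.norm_eq_abs, sq_abs,
    norm_sub_rev v z] at hsmooth
  have hopt := hls σ ⟨hσ0, hσ1⟩
  have hdir' := mul_le_mul_of_nonneg_left hdir hσ0
  have hdiam' : α * σ ^ 2 / 2 * ‖z - v‖ ^ 2 ≤ α * σ ^ 2 / 2 * D ^ 2 := by
    gcongr
    exact hdiam z hzK v hvK
  linarith
end
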